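/- Let u be a smooth solution of u_{tt} − ∇·(K∇u) = 0 on (0,∞)×ℝ² with compactly supported smooth initial data u(0)=u₀, u_t(0)=u₁, where K ∈ BC¹(ℝ²). Then the Morawetz identity holds: t E_u(t) + ½∫_{ℝ²} u_t(t,x)u(t,x) dx + ∫_{ℝ²} u_t(t,x)(x·∇u(t,x)) dx = J₀ + ½∫₀^t ∫_{ℝ²} (x·∇K(x))|∇u(s,x)|² dx ds, where E_u(t) = ½(‖u_t(t)‖² + ‖√K ∇u(t)‖²) and J₀ = ½∫ u₁u₀ dx + ∫ u₁ (x·∇u₀) dx. -/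

import Mathlib

open MeasureTheory Real Set
open scoped RealInnerProductSpace

/-- Divergence of a vector field on `ℝ²`. -/
noncomputable def div2 (F : EuclideanSpace ℝ (Fin 2) → EuclideanSpace ℝ (Fin 2))
    (x : EuclideanSpace ℝ (Fin 2)) : ℝ :=
  ∑ i : Fin 2, fderiv ℝ F x (EuclideanSpace.single i 1) i

/-- The plane. -/
abbrev E2 := EuclideanSpace ℝ (Fin 2)

/-- Directional derivative in space-time. -/
noncomputable def DD (v : ℝ × E2) (f : ℝ × E2 → ℝ) (p : ℝ × E2) : ℝ := fderiv ℝ f p v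

/-- Coordinate vectors. -/
noncomputable def ee (i : Fin 2) : E2 := EuclideanSpace.single i 1

/-- Time derivative. -/
noncomputable def Dt (f : ℝ × E2 → ℝ) : ℝ × E2 → ℝ := DD (1, 0) f
/-- Space derivative. -/
noncomputable def Dx (i : Fin 2) (f : ℝ × E2 → ℝ) : ℝ × E2 → ℝ := DD (0, ee i) f

lemma DD_smooth {v : ℝ × E2} {f : ℝ × E2 → ℝ} (hf : ContDiff ℝ (⊤ : ℕ∞) f) :
    ContDiff ℝ (⊤ : ℕ∞) (DD v f) := by
  unfold DD
  exact (hf.fderiv_right (m := (⊤ : ℕ∞)) (by simp)).clm_apply contDiff_const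

lemma Dt_smooth {f : ℝ × E2 → ℝ} (hf : ContDiff ℝ (⊤ : ℕ∞) f) :
    ContDiff ℝ (⊤ : ℕ∞) (Dt f) := DD_smooth hf
lemma Dx_smooth {f : ℝ × E2 → ℝ} (i : Fin 2) (hf : ContDiff ℝ (⊤ : ℕ∞) f) :
    ContDiff ℝ (⊤ : ℕ∞) (Dx i f) := DD_smooth hf

lemma DD_comm {v w : ℝ × E2} {f : ℝ × E2 → ℝ} (hf : ContDiff ℝ (⊤ : ℕ∞) f) :
    DD v (DD w f) = DD w (DD v f) := by
  have hd : Differentiable ℝ (fderiv ℝ f) :=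
    (hf.fderiv_right (m := (⊤ : ℕ∞)) (by simp)).differentiable (by simp)
  have key : ∀ v w p, DD v (DD w f) p = fderiv ℝ (fderiv ℝ f) p v w := by
    intro v w p
    have h := ((hd p).hasFDerivAt.clm_apply (hasFDerivAt_const w p)).fderiv
    have h2 : DD w f = fun y => (fderiv ℝ f y) w := rfl
    rw [DD, h2, h]
    simp
  funext p
  rw [key, key]
  have := (hf.contDiffAt (x := p)).isSymmSndFDerivAt (by
    simp only [minSmoothness_of_isRCLikeNormedField]
    exact (WithTop.coe_le_coe.2 le_top : ((2 : ℕ∞) : WithTop ℕ∞) ≤ ((⊤ : ℕ∞) : WithTop ℕ∞)))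
  exact this v w

lemma Dt_Dx {f : ℝ × E2 → ℝ} (i : Fin 2) (hf : ContDiff ℝ (⊤ : ℕ∞) f) :
    Dt (Dx i f) = Dx i (Dt f) := DD_comm hf

lemma Dt_hasDerivAt {f : ℝ × E2 → ℝ} (hf : ContDiff ℝ (⊤ : ℕ∞) f) (t : ℝ) (x : E2) :
    HasDerivAt (fun s => f (s, x)) (Dt f (t, x)) t := by
  have h1 : HasFDerivAt f (fderiv ℝ f (t, x)) (t, x) :=
    (hf.differentiable (by simp) _).hasFDerivAt
  have h2 : HasDerivAt (fun s : ℝ => ((s, x) : ℝ × E2)) (1, 0) t :=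
    (hasDerivAt_id t).prodMk (hasDerivAt_const t x)
  exact h1.comp_hasDerivAt t h2

lemma line_hasDerivAt (x v : E2) : HasDerivAt (fun s : ℝ => x + s • v) v 0 := by
  simpa using ((hasDerivAt_id (0 : ℝ)).smul_const v).const_add x

lemma Dx_hasDerivAt {f : ℝ × E2 → ℝ} (hf : ContDiff ℝ (⊤ : ℕ∞) f) (i : Fin 2) (t : ℝ) (x : E2) :
    HasDerivAt (fun s : ℝ => f (t, x + s • ee i)) (Dx i f (t, x)) 0 := by
  have h1 : HasFDerivAt f (fderiv ℝ f (t, x)) (t, x + (0 : ℝ) • ee i) := by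
    simpa using (hf.differentiable (by simp) (t, x)).hasFDerivAt
  have h2 : HasDerivAt (fun s : ℝ => ((t, x + s • ee i) : ℝ × E2)) (0, ee i) 0 :=
    (hasDerivAt_const (0 : ℝ) t).prodMk (line_hasDerivAt x (ee i))
  exact h1.comp_hasDerivAt (0 : ℝ) h2

/-- Space derivative of a function of the space variable. -/
noncomputable def Ds (i : Fin 2) (K : E2 → ℝ) (x : E2) : ℝ := fderiv ℝ K x (ee i)

lemma Ds_cont {K : E2 → ℝ} (hK : ContDiff ℝ 1 K) (i : Fin 2) : Continuous (Ds i K) := by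
  unfold Ds
  exact (hK.continuous_fderiv (by simp)).clm_apply continuous_const

lemma Ds_hasDerivAt {K : E2 → ℝ} (hK : ContDiff ℝ 1 K) (i : Fin 2) (x : E2) :
    HasDerivAt (fun s : ℝ => K (x + s • ee i)) (Ds i K x) 0 := by
  have h1 : HasFDerivAt K (fderiv ℝ K x) (x + (0 : ℝ) • ee i) := by
    simpa using (hK.differentiable (by simp) x).hasFDerivAt
  exact h1.comp_hasDerivAt (0 : ℝ) (line_hasDerivAt x (ee i))

lemma coord_hasDerivAt (i j : Fin 2) (x : E2) :
    HasDerivAt (fun s : ℝ => (x + s • ee i) j) (if j = i then 1 else 0) 0 := by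
  have : (fun s : ℝ => (x + s • ee i) j) = fun s => x j + s * (if j = i then 1 else 0) := by
    funext s; simp [ee]
  rw [this]
  simpa using ((hasDerivAt_id (0 : ℝ)).mul_const (if j = i then (1 : ℝ) else 0)).const_add (x j)

/-- Solution of the wave equation in non-divergence form. -/
def Sol (K : E2 → ℝ) (f : ℝ × E2 → ℝ) : Prop :=
  ∀ t x, 0 ≤ t → Dt (Dt f) (t, x) =
    (Ds 0 K x * Dx 0 f (t, x) + K x * Dx 0 (Dx 0 f) (t, x)) +
    (Ds 1 K x * Dx 1 f (t, x) + K x * Dx 1 (Dx 1 f) (t, x))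

lemma Sol_of_pos {K : E2 → ℝ} {f : ℝ × E2 → ℝ} (hf : ContDiff ℝ (⊤ : ℕ∞) f)
    (h : ∀ t x, 0 < t → Dt (Dt f) (t, x) =
    (Ds 0 K x * Dx 0 f (t, x) + K x * Dx 0 (Dx 0 f) (t, x)) +
    (Ds 1 K x * Dx 1 f (t, x) + K x * Dx 1 (Dx 1 f) (t, x))) : Sol K f := by
  intro t x ht
  have c1 := (Dt_smooth (Dt_smooth hf)).continuous
  have c2 := fun i => (Dx_smooth i hf).continuous
  have c3 := fun i => (Dx_smooth i (Dx_smooth i hf)).continuous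
  have c20 := c2 0
  have c21 := c2 1
  have c30 := c3 0
  have c31 := c3 1
  have hcl : IsClosed {s : ℝ | Dt (Dt f) (s, x) =
    (Ds 0 K x * Dx 0 f (s, x) + K x * Dx 0 (Dx 0 f) (s, x)) +
    (Ds 1 K x * Dx 1 f (s, x) + K x * Dx 1 (Dx 1 f) (s, x))} := by
    apply isClosed_eq <;> fun_prop
  have : closure (Ioi (0 : ℝ)) ⊆ _ := hcl.closure_subset_iff.2 (fun s hs => h s x hs)
  rw [closure_Ioi] at this
  exact this ht

lemma Sol_Dt {K : E2 → ℝ} {f : ℝ × E2 → ℝ} (hf : ContDiff ℝ (⊤ : ℕ∞) f)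
    (h : Sol K f) : Sol K (Dt f) := by
  apply Sol_of_pos (Dt_smooth hf)
  intro t x ht
  have e1 := Dt_hasDerivAt (Dt_smooth (Dt_smooth hf)) t x
  have a := fun i => (Dt_hasDerivAt (Dx_smooth i hf) t x).const_mul (Ds i K x)
  have b := fun i => (Dt_hasDerivAt (Dx_smooth i (Dx_smooth i hf)) t x).const_mul (K x)
  have e2 := ((a 0).add (b 0)).add ((a 1).add (b 1))
  have e3 := e2.congr_of_eventuallyEq (f₁ := fun s => Dt (Dt f) (s, x)) (by
    filter_upwards [Ioi_mem_nhds ht] with s hs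
    simpa using h s x (le_of_lt hs))
  have := e1.unique e3
  rw [this]
  simp only [Dt_Dx _ (Dx_smooth _ hf), Dt_Dx _ hf]

lemma hasLine_integral_zero {V dV : E2 → ℝ} {C : Set E2} (hC : IsCompact C) (i : Fin 2)
    (hV : Continuous V) (hdV : Continuous dV)
    (hd : ∀ x, HasDerivAt (fun s : ℝ => V (x + s • ee i)) (dV x) 0)
    (hz : ∀ x, x ∉ C → V x = 0) : (∀ x, x ∉ C → dV x = 0) ∧ ∫ x, dV x = 0 := by
  have hz' : ∀ x, x ∉ C → dV x = 0 := by
    intro x hx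
    have ho : IsOpen (Cᶜ) := hC.isClosed.isOpen_compl
    have hc : Continuous (fun s : ℝ => x + s • ee i) := by fun_prop
    have h0 : ∀ᶠ s : ℝ in nhds 0, x + s • ee i ∈ Cᶜ :=
      hc.continuousAt.eventually (ho.mem_nhds (by simpa using hx))
    have h1 : HasDerivAt (fun s : ℝ => V (x + s • ee i)) 0 0 :=
      (hasDerivAt_const (0 : ℝ) (0 : ℝ)).congr_of_eventuallyEq (by
        filter_upwards [h0] with s hs using hz _ hs)
    exact (hd x).unique h1
  refine ⟨hz', ?_⟩
  have i1 : Integrable V := hV.integrable_of_hasCompactSupport (HasCompactSupport.intro hC hz)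
  have i2 : Integrable dV := hdV.integrable_of_hasCompactSupport (HasCompactSupport.intro hC hz')
  have := integral_bilinear_hasLineDerivAt_right_eq_neg_left_of_integrable
    (μ := (volume : Measure E2)) (f := fun _ => (1 : ℝ)) (f' := fun _ => (0 : ℝ)) (g := V) (g' := dV)
    (v := ee i) (B := ContinuousLinearMap.mul ℝ ℝ) (by simp) (by simpa using i2)
    (by simpa using i1) (fun x _ => by simpa [HasLineDerivAt] using hasDerivAt_const (0 : ℝ) (1 : ℝ))
    (fun x _ => hd x)
  simpa using this

/-- Subtracting a divergence does not change the integral. -/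
lemma integral_sub_div {G V0 V1 d0 d1 : E2 → ℝ} {C : Set E2} (hC : IsCompact C)
    (hG : Continuous G) (hGz : ∀ x, x ∉ C → G x = 0)
    (hV0 : Continuous V0) (hV1 : Continuous V1) (hd0 : Continuous d0) (hd1 : Continuous d1)
    (h0 : ∀ x, HasDerivAt (fun s : ℝ => V0 (x + s • ee 0)) (d0 x) 0)
    (h1 : ∀ x, HasDerivAt (fun s : ℝ => V1 (x + s • ee 1)) (d1 x) 0)
    (z0 : ∀ x, x ∉ C → V0 x = 0) (z1 : ∀ x, x ∉ C → V1 x = 0) :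
    ∫ x, G x = ∫ x, (G x - d0 x - d1 x) := by
  obtain ⟨a0, b0⟩ := hasLine_integral_zero hC 0 hV0 hd0 h0 z0
  obtain ⟨a1, b1⟩ := hasLine_integral_zero hC 1 hV1 hd1 h1 z1
  have iG : Integrable G := hG.integrable_of_hasCompactSupport (HasCompactSupport.intro hC hGz)
  have i0 : Integrable d0 := hd0.integrable_of_hasCompactSupport (HasCompactSupport.intro hC a0)
  have i1 : Integrable d1 := hd1.integrable_of_hasCompactSupport (HasCompactSupport.intro hC a1)
  have i01 : Integrable (fun x => G x - d0 x) := iG.sub i0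
  rw [integral_sub i01 i1, integral_sub iG i0, b0, b1]
  simp

lemma deriv_zero_off {F F' : ℝ × E2 → ℝ} {C : Set E2} {a b : ℝ} (hab : a < b)
    (hF' : Continuous F')
    (hd : ∀ t ∈ Ioo a b, ∀ x, HasDerivAt (fun s => F (s, x)) (F' (t, x)) t)
    (hz : ∀ t ∈ Icc a b, ∀ x, x ∉ C → F (t, x) = 0) :
    ∀ t ∈ Icc a b, ∀ x, x ∉ C → F' (t, x) = 0 := by
  intro t ht x hx
  have hcl : IsClosed {s : ℝ | F' (s, x) = 0} := by
    apply isClosed_eq <;> fun_prop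
  have h1 : Ioo a b ⊆ {s : ℝ | F' (s, x) = 0} := by
    intro s hs
    have : HasDerivAt (fun s => F (s, x)) 0 s :=
      (hasDerivAt_const s (0 : ℝ)).congr_of_eventuallyEq (by
        filter_upwards [Ioo_mem_nhds hs.1 hs.2] with r hr
        exact hz r (Ioo_subset_Icc_self hr) x hx)
    exact (hd s hs x).unique this
  have h2 := hcl.closure_subset_iff.2 h1
  rw [closure_Ioo hab.ne] at h2
  exact h2 ht

lemma contOn_int {G : ℝ × E2 → ℝ} {C : Set E2} {s : Set ℝ} (hC : IsCompact C)
    (hG : Continuous G) (hz : ∀ t ∈ s, ∀ x, x ∉ C → G (t, x) = 0) :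
    ContinuousOn (fun t => ∫ x, G (t, x)) s := by
  apply continuousOn_integral_of_compact_support (k := C) (f := fun t x => G (t, x)) hC
  · exact hG.continuousOn
  · intro p x hp hx; exact hz p hp x hx

lemma intervalInt_int {G : ℝ × E2 → ℝ} {C : Set E2} {a b : ℝ} (hab : a ≤ b) (hC : IsCompact C)
    (hG : Continuous G) (hz : ∀ t ∈ Icc a b, ∀ x, x ∉ C → G (t, x) = 0) :
    IntervalIntegrable (fun t => ∫ x, G (t, x)) volume a b := by
  apply ContinuousOn.intervalIntegrable
  rw [uIcc_of_le hab]
  exact contOn_int hC hG hz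

lemma slice_int {G : ℝ × E2 → ℝ} {C : Set E2} {t : ℝ} (hC : IsCompact C)
    (hG : Continuous G) (hz : ∀ x, x ∉ C → G (t, x) = 0) : Integrable (fun x => G (t, x)) :=
  Continuous.integrable_of_hasCompactSupport (by fun_prop) (HasCompactSupport.intro hC hz)

/-- Fundamental theorem of calculus under the integral sign. -/
lemma ftc_int {F F' : ℝ × E2 → ℝ} {C : Set E2} {a b : ℝ} (hab : a < b) (hC : IsCompact C)
    (hF : Continuous F) (hF' : Continuous F')
    (hd : ∀ t ∈ Ioo a b, ∀ x, HasDerivAt (fun s => F (s, x)) (F' (t, x)) t)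
    (hz : ∀ t ∈ Icc a b, ∀ x, x ∉ C → F (t, x) = 0) :
    (∫ x, F (b, x)) - (∫ x, F (a, x)) = ∫ t in a..b, ∫ x, F' (t, x) := by
  have hz' := deriv_zero_off hab hF' hd hz
  rw [← integral_sub (slice_int hC hF (hz b (right_mem_Icc.2 hab.le)))
    (slice_int hC hF (hz a (left_mem_Icc.2 hab.le)))]
  have h1 : ∀ x, F (b, x) - F (a, x) = ∫ t in a..b, F' (t, x) := by
    intro x
    rw [intervalIntegral.integral_eq_sub_of_hasDerivAt_of_le hab.le]
    · fun_prop
    · intro t ht; exact hd t ht x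
    · apply Continuous.intervalIntegrable; fun_prop
  simp_rw [h1, intervalIntegral.integral_of_le hab.le]
  rw [integral_integral_swap]
  have hon : IntegrableOn (fun p : E2 × ℝ => F' (p.2, p.1)) (C ×ˢ Icc a b) := by
    apply ContinuousOn.integrableOn_compact (hC.prod isCompact_Icc)
    fun_prop
  have hon2 : IntegrableOn (fun p : E2 × ℝ => F' (p.2, p.1)) (univ ×ˢ Ioc a b) := by
    have h3 : IntegrableOn (fun p : E2 × ℝ => F' (p.2, p.1)) (univ ×ˢ Icc a b) := by
      apply IntegrableOn.of_forall_sdiff_eq_zero hon (MeasurableSet.univ.prod measurableSet_Icc)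
      rintro ⟨x, t⟩ ⟨⟨_, h1⟩, h2⟩
      apply hz' t h1 x
      intro hx
      exact h2 ⟨hx, h1⟩
    exact h3.mono_set (prod_mono le_rfl Ioc_subset_Icc_self)
  rw [IntegrableOn, Measure.volume_eq_prod, ← Measure.prod_restrict, Measure.restrict_univ] at hon2
  exact hon2

lemma hasDerivAt_posSq (y : ℝ) : HasDerivAt (fun y : ℝ => (max y 0) ^ 2) (2 * max y 0) y := by
  rcases lt_trichotomy y 0 with h | h | h
  · rw [max_eq_right h.le]
    simp only [mul_zero]
    apply (hasDerivAt_const y (0 : ℝ)).congr_of_eventuallyEq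
    filter_upwards [Iio_mem_nhds h] with z hz
    rw [max_eq_right (le_of_lt hz)]; simp
  · subst h
    rw [hasDerivAt_iff_isLittleO_nhds_zero]
    simp only [zero_add, max_self, mul_zero, smul_zero, sub_zero, ne_eq, OfNat.ofNat_ne_zero,
      not_false_eq_true, zero_pow]
    have h1 : (fun h : ℝ => (max h 0) ^ 2) =O[nhds 0] (fun h : ℝ => h ^ 2) := by
      apply Asymptotics.isBigO_of_le
      intro x
      simp only [norm_pow]
      apply pow_le_pow_left₀ (norm_nonneg _)
      simp only [Real.norm_eq_abs]
      rcases le_total x 0 with h | h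
      · simp [max_eq_right h]
      · simp [max_eq_left h]
    have h2 : (fun h : ℝ => h ^ 2) =o[nhds 0] (fun h : ℝ => h) := by
      simpa using Asymptotics.isLittleO_pow_pow (𝕜 := ℝ) (m := 1) (n := 2) (by norm_num)
    simpa using h1.trans_isLittleO h2
  · rw [max_eq_left h.le]
    have := (hasDerivAt_pow 2 y)
    simp only [Nat.cast_ofNat] at this
    have h3 := this.congr_of_eventuallyEq (f₁ := fun y : ℝ => (max y 0) ^ 2) (by
      filter_upwards [Ioi_mem_nhds h] with z hz
      rw [max_eq_left (le_of_lt hz)])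
    simpa using h3

lemma E2_norm_sq (x : E2) : ‖x‖ ^ 2 = x 0 ^ 2 + x 1 ^ 2 := by
  rw [EuclideanSpace.norm_sq_eq]; simp

lemma cone_ineq {c b k p f0 f1 y0 y1 : ℝ} (hc : 0 < c) (hb : 0 < b) (hk : |k| ≤ c ^ 2)
    (hpos : 0 ≤ k * (f0 ^ 2 + f1 ^ 2)) (hy : y0 ^ 2 + y1 ^ 2 ≤ b ^ 2) :
    p * k * (y0 * f0 + y1 * f1) ≤ c * b * ((p ^ 2 + k * (f0 ^ 2 + f1 ^ 2)) / 2) := by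
  apply le_of_abs_le
  apply abs_le_of_sq_le_sq _ (by positivity)
  have h1 : (y0 * f0 + y1 * f1) ^ 2 ≤ b ^ 2 * (f0 ^ 2 + f1 ^ 2) := by
    have : (y0 * f0 + y1 * f1) ^ 2 ≤ (y0 ^ 2 + y1 ^ 2) * (f0 ^ 2 + f1 ^ 2) := by
      nlinarith [sq_nonneg (y0 * f1 - y1 * f0)]
    exact this.trans (mul_le_mul_of_nonneg_right hy (by positivity))
  have hk2 : k ≤ c ^ 2 := (le_abs_self k).trans hk
  set w := k * (f0 ^ 2 + f1 ^ 2) with hw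
  calc (p * k * (y0 * f0 + y1 * f1)) ^ 2 = (p * k) ^ 2 * (y0 * f0 + y1 * f1) ^ 2 := by ring
    _ ≤ (p * k) ^ 2 * (b ^ 2 * (f0 ^ 2 + f1 ^ 2)) := by gcongr
    _ = p ^ 2 * b ^ 2 * (k * w) := by rw [hw]; ring
    _ ≤ p ^ 2 * b ^ 2 * (c ^ 2 * w) := by gcongr
    _ = (c * b) ^ 2 * (p ^ 2 * w) := by ring
    _ ≤ (c * b) ^ 2 * ((p ^ 2 + w) / 2) ^ 2 := by
        gcongr
        nlinarith [sq_nonneg (p ^ 2 - w)]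
    _ = _ := by ring

set_option maxHeartbeats 1000000 in
lemma cone {K : E2 → ℝ} (hK : ContDiff ℝ 1 K) {f : ℝ × E2 → ℝ} (hf : ContDiff ℝ (⊤ : ℕ∞) f)
    (hS : Sol K f) {c R : ℝ} (hc : 0 < c) (hKc : ∀ x, |K x| ≤ c ^ 2)
    (h0 : ∀ x, R < ‖x‖ → f (0, x) = 0) (h1 : ∀ x, R < ‖x‖ → Dt f (0, x) = 0)
    (hpos : ∀ t x, 0 ≤ t → R < ‖x‖ → 0 ≤ K x * (Dx 0 f (t, x) ^ 2 + Dx 1 f (t, x) ^ 2))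
    {T : ℝ} (hT : 0 ≤ T) {z : E2} (hz : R + c * T < ‖z‖) : Dt f (T, z) = 0 := by
  rcases hT.eq_or_lt with hT0 | hT0
  · subst hT0; exact h1 z (by linarith)
  -- margin
  obtain ⟨δ, hδ, hδz⟩ : ∃ δ > 0, R + c * T + δ < ‖z‖ :=
    ⟨(‖z‖ - (R + c * T)) / 2, by linarith, by linarith⟩
  set a := c * T + δ with ha
  have hK0 := hK.continuous
  have hKd := Ds_cont hK
  have hKd0 := hKd 0
  have hKd1 := hKd 1
  have cf := hf.continuous
  have ct := (Dt_smooth hf).continuous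
  have ctt := (Dt_smooth (Dt_smooth hf)).continuous
  have cx0 := (Dx_smooth 0 hf).continuous
  have cx1 := (Dx_smooth 1 hf).continuous
  have cx00 := (Dx_smooth 0 (Dx_smooth 0 hf)).continuous
  have cx11 := (Dx_smooth 1 (Dx_smooth 1 hf)).continuous
  have ctx0 := (Dx_smooth 0 (Dt_smooth hf)).continuous
  have ctx1 := (Dx_smooth 1 (Dt_smooth hf)).continuous
  let q : ℝ × E2 → ℝ := fun p => (a - c * p.1) ^ 2 - (p.2 0 - z 0) ^ 2 - (p.2 1 - z 1) ^ 2
  have cq : Continuous q := by fun_prop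
  let F : ℝ × E2 → ℝ := fun p => (max (q p) 0) ^ 2 *
    (1 / 2 * (Dt f p ^ 2 + K p.2 * (Dx 0 f p ^ 2 + Dx 1 f p ^ 2)))
  let F' : ℝ × E2 → ℝ := fun p => 2 * max (q p) 0 * (-(2 * c * (a - c * p.1))) *
    (1 / 2 * (Dt f p ^ 2 + K p.2 * (Dx 0 f p ^ 2 + Dx 1 f p ^ 2))) +
    (max (q p) 0) ^ 2 * (Dt f p * Dt (Dt f) p + K p.2 *
      (Dx 0 f p * Dx 0 (Dt f) p + Dx 1 f p * Dx 1 (Dt f) p))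
  have cF : Continuous F := by fun_prop
  have cF' : Continuous F' := by fun_prop
  let C : Set E2 := Metric.closedBall z a
  have hC : IsCompact C := isCompact_closedBall z a
  have bpos : ∀ t ∈ Icc (0 : ℝ) T, 0 < a - c * t := by
    intro t ht
    have := mul_le_mul_of_nonneg_left ht.2 hc.le
    linarith
  have hsq : ∀ x : E2, ‖x - z‖ ^ 2 = (x 0 - z 0) ^ 2 + (x 1 - z 1) ^ 2 := by
    intro x; rw [E2_norm_sq]; simp
  have hq : ∀ t ∈ Icc (0 : ℝ) T, ∀ x, x ∉ C → max (q (t, x)) 0 = 0 := by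
    intro t ht x hx
    apply max_eq_right
    have h2 : a < ‖x - z‖ := by simpa [C, dist_eq_norm] using hx
    have h3 := bpos t ht
    have h4 : 0 ≤ c * t := mul_nonneg hc.le ht.1
    have h5 : (a - c * t) ^ 2 ≤ ‖x - z‖ ^ 2 := by
      apply pow_le_pow_left₀ h3.le; linarith
    rw [hsq] at h5
    simp only [q]; linarith
  have hout : ∀ x ∈ C, R < ‖x‖ := by
    intro x hx
    have h2 : ‖x - z‖ ≤ a := by simpa [C, dist_eq_norm] using hx
    have h3 := norm_sub_norm_le z x
    rw [norm_sub_rev] at h3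
    linarith
  have hFz : ∀ t ∈ Icc (0 : ℝ) T, ∀ x, x ∉ C → F (t, x) = 0 := by
    intro t ht x hx; simp [F, hq t ht x hx]
  have hd : ∀ t ∈ Ioo (0 : ℝ) T, ∀ x, HasDerivAt (fun s => F (s, x)) (F' (t, x)) t := by
    intro t _ x
    have d1 : HasDerivAt (fun s => q (s, x)) (-(2 * c * (a - c * t))) t := by
      have := (((((hasDerivAt_id t).const_mul c).const_sub a).pow 2).sub_const
        ((x 0 - z 0) ^ 2)).sub_const ((x 1 - z 1) ^ 2)
      exact this.congr_deriv (by simp; ring)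
    have d2 := (hasDerivAt_posSq (q (t, x))).comp t d1
    have e0 := Dt_hasDerivAt (Dx_smooth 0 hf) t x
    have e1 := Dt_hasDerivAt (Dx_smooth 1 hf) t x
    rw [Dt_Dx _ hf] at e0 e1
    have d3 := (((Dt_hasDerivAt (Dt_smooth hf) t x).pow 2).add
      (((e0.pow 2).add (e1.pow 2)).const_mul (K x))).const_mul (1 / 2)
    exact (d2.mul d3).congr_deriv (by
      simp only [F', Function.comp, Nat.cast_ofNat, Nat.reduceSub, pow_one, Pi.add_apply, Pi.pow_apply]
      ring)
  have hftc := ftc_int hT0 hC cF cF' hd hFz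
  have hF'z := deriv_zero_off hT0 cF' hd hFz
  have hneg : ∀ t ∈ Icc (0 : ℝ) T, ∫ x, F' (t, x) ≤ 0 := by
    intro t ht
    have dq : ∀ (i : Fin 2) (x : E2), HasDerivAt (fun s : ℝ => (max (q (t, x + s • ee i)) 0) ^ 2)
        (2 * max (q (t, x)) 0 * (-(2 * (x i - z i)))) 0 := by
      intro i x
      have d1 : HasDerivAt (fun s : ℝ => q (t, x + s • ee i)) (-(2 * (x i - z i))) 0 := by
        have := ((((coord_hasDerivAt i 0 x).sub_const (z 0)).pow 2).const_sub
          ((a - c * t) ^ 2)).sub (((coord_hasDerivAt i 1 x).sub_const (z 1)).pow 2)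
        exact this.congr_deriv (by fin_cases i <;> simp)
      have d2 : HasDerivAt (fun y : ℝ => (max y 0) ^ 2) (2 * max (q (t, x)) 0)
        (q (t, x + (0 : ℝ) • ee i)) := by simpa using hasDerivAt_posSq (q (t, x))
      exact d2.comp (0 : ℝ) d1
    have key := integral_sub_div hC (G := fun x => F' (t, x))
      (V0 := fun x => (max (q (t, x)) 0) ^ 2 * (Dt f (t, x) * (K x * Dx 0 f (t, x))))
      (V1 := fun x => (max (q (t, x)) 0) ^ 2 * (Dt f (t, x) * (K x * Dx 1 f (t, x))))
      (d0 := fun x => 2 * max (q (t, x)) 0 * (-(2 * (x 0 - z 0))) *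
          (Dt f (t, x) * (K x * Dx 0 f (t, x))) +
        (max (q (t, x)) 0) ^ 2 * (Dx 0 (Dt f) (t, x) * (K x * Dx 0 f (t, x)) +
          Dt f (t, x) * (Ds 0 K x * Dx 0 f (t, x) + K x * Dx 0 (Dx 0 f) (t, x))))
      (d1 := fun x => 2 * max (q (t, x)) 0 * (-(2 * (x 1 - z 1))) *
          (Dt f (t, x) * (K x * Dx 1 f (t, x))) +
        (max (q (t, x)) 0) ^ 2 * (Dx 1 (Dt f) (t, x) * (K x * Dx 1 f (t, x)) +
          Dt f (t, x) * (Ds 1 K x * Dx 1 f (t, x) + K x * Dx 1 (Dx 1 f) (t, x))))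
      (by fun_prop) (hF'z t ht) (by fun_prop) (by fun_prop) (by fun_prop) (by fun_prop)
      (by
        intro x
        have := (dq 0 x).mul ((Dx_hasDerivAt (Dt_smooth hf) 0 t x).mul
          ((Ds_hasDerivAt hK 0 x).mul (Dx_hasDerivAt (Dx_smooth 0 hf) 0 t x)))
        exact this.congr_deriv (by simp))
      (by
        intro x
        have := (dq 1 x).mul ((Dx_hasDerivAt (Dt_smooth hf) 1 t x).mul
          ((Ds_hasDerivAt hK 1 x).mul (Dx_hasDerivAt (Dx_smooth 1 hf) 1 t x)))
        exact this.congr_deriv (by simp))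
      (by intro x hx; simp [hq t ht x hx]) (by intro x hx; simp [hq t ht x hx])
    rw [key]
    apply integral_nonpos
    intro x
    simp only [Pi.zero_apply, F']
    rw [hS t x ht.1]
    by_cases hx : x ∈ C
    swap
    · simp [hq t ht x hx]
    rcases le_or_gt (q (t, x)) 0 with hq0 | hq0
    · simp [max_eq_right hq0]
    have h3 := bpos t ht
    have := cone_ineq (p := Dt f (t, x)) (y0 := x 0 - z 0) (y1 := x 1 - z 1) hc h3 (hKc x)
      (hpos t x ht.1 (hout x hx)) (by simp only [q] at hq0; linarith)
    rw [max_eq_left hq0.le]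
    have h5 := mul_le_mul_of_nonneg_left this (by positivity : 0 ≤ 4 * q (t, x))
    refine le_of_eq_of_le (b := 4 * q (t, x) * (Dt f (t, x) * K x *
      ((x 0 - z 0) * Dx 0 f (t, x) + (x 1 - z 1) * Dx 1 f (t, x))) - 4 * q (t, x) *
      (c * (a - c * t) * ((Dt f (t, x) ^ 2 + K x * (Dx 0 f (t, x) ^ 2 + Dx 1 f (t, x) ^ 2)) / 2)))
      ?_ (sub_nonpos.2 h5)
    ring
  have hle : ∫ t in (0 : ℝ)..T, ∫ x, F' (t, x) ≤ 0 := by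
    rw [intervalIntegral.integral_of_le hT]
    apply setIntegral_nonpos measurableSet_Ioc
    intro t ht
    exact hneg t (Ioc_subset_Icc_self ht)
  have hF0 : ∀ x, F (0, x) = 0 := by
    intro x
    by_cases hx : x ∈ C
    swap
    · exact hFz 0 ⟨le_rfl, hT⟩ x hx
    have hxR := hout x hx
    have hxx : ∀ i, Dx i f (0, x) = 0 := by
      intro i
      have ho : IsOpen {y : E2 | R < ‖y‖} := isOpen_lt continuous_const continuous_norm
      have hcc : Continuous (fun s : ℝ => x + s • ee i) := by fun_prop
      have hev : ∀ᶠ s : ℝ in nhds 0, x + s • ee i ∈ {y : E2 | R < ‖y‖} :=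
        hcc.continuousAt.eventually (ho.mem_nhds (by simpa using hxR))
      have h1 : HasDerivAt (fun s : ℝ => f (0, x + s • ee i)) 0 0 :=
        (hasDerivAt_const (0 : ℝ) (0 : ℝ)).congr_of_eventuallyEq (by
          filter_upwards [hev] with s hs using h0 _ hs)
      exact (Dx_hasDerivAt hf i 0 x).unique h1
    simp [F, hxx, h1 x hxR]
  have hFT : ∫ x, F (T, x) ≤ 0 := by
    have : ∫ x, F (0, x) = 0 := by simp [hF0]
    linarith
  have hnn : ∀ x, 0 ≤ F (T, x) := by
    intro x
    by_cases hx : x ∈ C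
    · have := hpos T x hT (hout x hx)
      simp only [F]; positivity
    · rw [hFz T ⟨hT, le_rfl⟩ x hx]
  have hFTz : F (T, z) = 0 := by
    by_contra hne
    have := Continuous.integral_pos_of_hasCompactSupport_nonneg_nonzero (μ := volume)
      (f := fun x => F (T, x)) (x := z) (by fun_prop)
      (HasCompactSupport.intro hC (hFz T ⟨hT, le_rfl⟩)) hnn hne
    linarith
  have hqz : q (T, z) = δ ^ 2 := by simp [q, ha]
  have h6 := hpos T z hT (by nlinarith [mul_nonneg hc.le hT])
  have h7 : 0 < max (q (T, z)) 0 := by rw [hqz]; exact lt_max_of_lt_left (by positivity)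
  simp only [F, mul_eq_zero, pow_eq_zero_iff, ne_eq, OfNat.ofNat_ne_zero, not_false_eq_true,
    h7.ne', false_or] at hFTz
  have h8 : Dt f (T, z) ^ 2 = 0 := by
    rcases hFTz with h | h
    · norm_num at h
    · nlinarith [sq_nonneg (Dt f (T, z))]
  simpa using h8

lemma Dx_zero_of_open {f : ℝ × E2 → ℝ} (hf : ContDiff ℝ (⊤ : ℕ∞) f) {U : Set E2} (hU : IsOpen U)
    {t : ℝ} (h : ∀ x ∈ U, f (t, x) = 0) (i : Fin 2) : ∀ x ∈ U, Dx i f (t, x) = 0 := by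
  intro x hx
  have hcc : Continuous (fun s : ℝ => x + s • ee i) := by fun_prop
  have hev : ∀ᶠ s : ℝ in nhds 0, x + s • ee i ∈ U :=
    hcc.continuousAt.eventually (hU.mem_nhds (by simpa using hx))
  have h1 : HasDerivAt (fun s : ℝ => f (t, x + s • ee i)) 0 0 :=
    (hasDerivAt_const (0 : ℝ) (0 : ℝ)).congr_of_eventuallyEq (by
      filter_upwards [hev] with s hs using h _ hs)
  exact (Dx_hasDerivAt hf i t x).unique h1

lemma integral_sub_div_le {G H V0 V1 d0 d1 : E2 → ℝ} {C : Set E2} (hC : IsCompact C)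
    (hG : Continuous G) (hGz : ∀ x, x ∉ C → G x = 0)
    (hV0 : Continuous V0) (hV1 : Continuous V1) (hd0 : Continuous d0) (hd1 : Continuous d1)
    (h0 : ∀ x, HasDerivAt (fun s : ℝ => V0 (x + s • ee 0)) (d0 x) 0)
    (h1 : ∀ x, HasDerivAt (fun s : ℝ => V1 (x + s • ee 1)) (d1 x) 0)
    (z0 : ∀ x, x ∉ C → V0 x = 0) (z1 : ∀ x, x ∉ C → V1 x = 0)
    (hH : Integrable H) (hle : ∀ x, H x ≤ G x - d0 x - d1 x) :
    ∫ x, H x ≤ ∫ x, G x := by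
  rw [integral_sub_div hC hG hGz hV0 hV1 hd0 hd1 h0 h1 z0 z1]
  obtain ⟨a0, b0⟩ := hasLine_integral_zero hC 0 hV0 hd0 h0 z0
  obtain ⟨a1, b1⟩ := hasLine_integral_zero hC 1 hV1 hd1 h1 z1
  have iG : Integrable G := hG.integrable_of_hasCompactSupport (HasCompactSupport.intro hC hGz)
  have i0 : Integrable d0 := hd0.integrable_of_hasCompactSupport (HasCompactSupport.intro hC a0)
  have i1 : Integrable d1 := hd1.integrable_of_hasCompactSupport (HasCompactSupport.intro hC a1)
  exact integral_mono hH ((iG.sub i0).sub i1) hle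

lemma caccio_ineq {e p k s χ χ0 χ1 f f0 f1 Λ T : ℝ} {m : ℕ} (hk : 0 ≤ k) (hs : s ^ 2 ≤ T ^ 2)
    (hΛ : χ ^ 2 + k * T ^ 2 * (χ0 ^ 2 + χ1 ^ 2) ≤ Λ) :
    1 / 2 * (e ^ (2 * m + 2) * p ^ 2) - 2 * (m + 1) ^ 2 * Λ * (e ^ (2 * m) * f ^ 2) ≤
    e ^ (2 * m + 2) * (p ^ 2 + k * (f0 ^ 2 + f1 ^ 2)) +
      (2 * m + 2) * e ^ (2 * m + 1) * f * (-χ * p + k * s * (χ0 * f0 + χ1 * f1)) := by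
  have hE : 0 ≤ e ^ (2 * m) := by rw [pow_mul]; positivity
  set M : ℝ := (m : ℝ) + 1 with hM
  have h1 : χ ^ 2 + k * s ^ 2 * (χ0 ^ 2 + χ1 ^ 2) ≤ Λ := by
    refine le_trans ?_ hΛ
    gcongr
  have h2 : 2 * M ^ 2 * f ^ 2 * (χ ^ 2 + k * s ^ 2 * (χ0 ^ 2 + χ1 ^ 2)) ≤ 2 * M ^ 2 * f ^ 2 * Λ := by
    gcongr
  have h3 : 1 / 2 * (e ^ 2 * p ^ 2) - 2 * M ^ 2 * f ^ 2 * Λ ≤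
      e ^ 2 * (p ^ 2 + k * (f0 ^ 2 + f1 ^ 2)) +
      2 * M * e * f * (-χ * p + k * s * (χ0 * f0 + χ1 * f1)) := by
    have a1 := sq_nonneg (e * p - 2 * M * f * χ)
    have a2 := mul_nonneg hk (sq_nonneg (e * f0 + 2 * M * f * s * χ0))
    have a3 := mul_nonneg hk (sq_nonneg (e * f1 + 2 * M * f * s * χ1))
    have a4 := mul_nonneg hk (add_nonneg (sq_nonneg (e * f0)) (sq_nonneg (e * f1)))
    linarith
  have h4 := mul_le_mul_of_nonneg_left h3 hE
  have e1 : 2 * (m : ℝ) + 2 = 2 * M := by rw [hM]; ring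
  rw [e1]
  calc _ = e ^ (2 * m) * (1 / 2 * (e ^ 2 * p ^ 2) - 2 * M ^ 2 * f ^ 2 * Λ) := by ring
    _ ≤ _ := h4
    _ = _ := by ring

set_option maxHeartbeats 1000000 in
lemma caccio {K : E2 → ℝ} (hK : ContDiff ℝ 1 K) {f : ℝ × E2 → ℝ} (hf : ContDiff ℝ (⊤ : ℕ∞) f)
    (hS : Sol K f) {χ : E2 → ℝ} (hχ : ContDiff ℝ 1 χ) {C : Set E2} (hC : IsCompact C)
    (hχC : ∀ x, x ∉ C → χ x = 0) (hKC : ∀ x ∈ C, K x ≤ 0) (h0 : ∀ x ∈ C, f (0, x) = 0)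
    {T Λ : ℝ} (hT : 0 < T)
    (hΛ : ∀ x ∈ C, χ x ^ 2 + (-K x) * T ^ 2 * (Ds 0 χ x ^ 2 + Ds 1 χ x ^ 2) ≤ Λ)
    (m : ℕ) (hm : 1 ≤ m) :
    (∫ t in (0 : ℝ)..T, ∫ x, ((T - t) * χ x) ^ (2 * m + 2) * Dt f (t, x) ^ 2) ≤
      4 * (m + 1) ^ 2 * Λ *
      ∫ t in (0 : ℝ)..T, ∫ x, ((T - t) * χ x) ^ (2 * m) * f (t, x) ^ 2 := by
  have hK0 := hK.continuous
  have hKd0 := Ds_cont hK 0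
  have hKd1 := Ds_cont hK 1
  have hχ0 := hχ.continuous
  have hχd0 := Ds_cont hχ 0
  have hχd1 := Ds_cont hχ 1
  have cf := hf.continuous
  have ct := (Dt_smooth hf).continuous
  have ctt := (Dt_smooth (Dt_smooth hf)).continuous
  have cx0 := (Dx_smooth 0 hf).continuous
  have cx1 := (Dx_smooth 1 hf).continuous
  have cx00 := (Dx_smooth 0 (Dx_smooth 0 hf)).continuous
  have cx11 := (Dx_smooth 1 (Dx_smooth 1 hf)).continuous
  let F : ℝ × E2 → ℝ := fun p => ((T - p.1) * χ p.2) ^ (2 * m + 2) * (f p * Dt f p)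
  let F' : ℝ × E2 → ℝ := fun p =>
    (2 * m + 2) * ((T - p.1) * χ p.2) ^ (2 * m + 1) * (-χ p.2) * (f p * Dt f p) +
    ((T - p.1) * χ p.2) ^ (2 * m + 2) * (Dt f p ^ 2 + f p * Dt (Dt f) p)
  have cF : Continuous F := by fun_prop
  have cF' : Continuous F' := by fun_prop
  have hFz : ∀ t ∈ Icc (0 : ℝ) T, ∀ x, x ∉ C → F (t, x) = 0 := by
    intro t ht x hx; simp [F, hχC x hx]
  have hd : ∀ t ∈ Ioo (0 : ℝ) T, ∀ x, HasDerivAt (fun s => F (s, x)) (F' (t, x)) t := by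
    intro t _ x
    have d1 := ((((hasDerivAt_id t).const_sub T).mul_const (χ x)).pow (2 * m + 2)).mul
      ((Dt_hasDerivAt hf t x).mul (Dt_hasDerivAt (Dt_smooth hf) t x))
    refine d1.congr_deriv ?_
    simp only [F', id, Pi.mul_apply, Pi.pow_apply, Nat.add_succ_sub_one]
    push_cast
    ring
  have hftc := ftc_int hT hC cF cF' hd hFz
  have hF'z := deriv_zero_off hT cF' hd hFz
  have hF0 : ∀ x, F (0, x) = 0 := by
    intro x
    by_cases hx : x ∈ C
    · simp [F, h0 x hx]
    · simp [F, hχC x hx]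
  have hFT : ∀ x, F (T, x) = 0 := by intro x; simp [F]
  have hz : ∫ t in (0 : ℝ)..T, ∫ x, F' (t, x) = 0 := by
    rw [← hftc]; simp [hF0, hFT]
  let P : ℝ × E2 → ℝ := fun p => ((T - p.1) * χ p.2) ^ (2 * m + 2) * Dt f p ^ 2
  let Q : ℝ × E2 → ℝ := fun p => ((T - p.1) * χ p.2) ^ (2 * m) * f p ^ 2
  have cP : Continuous P := by fun_prop
  have cQ : Continuous Q := by fun_prop
  have Pz : ∀ t : ℝ, ∀ x, x ∉ C → P (t, x) = 0 := by
    intro t x hx; simp [P, hχC x hx]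
  have Qz : ∀ t : ℝ, ∀ x, x ∉ C → Q (t, x) = 0 := by
    intro t x hx
    have : m ≠ 0 := by omega
    simp [Q, hχC x hx, this]
  have hlow : ∀ t ∈ Icc (0 : ℝ) T, 1 / 2 * (∫ x, P (t, x)) -
      2 * (m + 1) ^ 2 * Λ * (∫ x, Q (t, x)) ≤ ∫ x, F' (t, x) := by
    intro t ht
    have dη : ∀ (i : Fin 2) (x : E2), HasDerivAt
        (fun s : ℝ => ((T - t) * χ (x + s • ee i)) ^ (2 * m + 2))
        ((2 * m + 2) * ((T - t) * χ x) ^ (2 * m + 1) * ((T - t) * Ds i χ x)) 0 := by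
      intro i x
      have := (((Ds_hasDerivAt hχ i x).const_mul (T - t)).pow (2 * m + 2))
      exact this.congr_deriv (by simp)
    let V : Fin 2 → E2 → ℝ := fun i x => ((T - t) * χ x) ^ (2 * m + 2) *
        (f (t, x) * (K x * Dx i f (t, x)))
    let d : Fin 2 → E2 → ℝ := fun i x =>
        (2 * m + 2) * ((T - t) * χ x) ^ (2 * m + 1) * ((T - t) * Ds i χ x) *
          (f (t, x) * (K x * Dx i f (t, x))) +
        ((T - t) * χ x) ^ (2 * m + 2) * (Dx i f (t, x) * (K x * Dx i f (t, x)) +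
          f (t, x) * (Ds i K x * Dx i f (t, x) + K x * Dx i (Dx i f) (t, x)))
    have i0 : ∀ i (x : E2), HasDerivAt (fun s : ℝ => V i (x + s • ee i)) (d i x) 0 := by
      intro i x
      have := (dη i x).mul ((Dx_hasDerivAt hf i t x).mul
          ((Ds_hasDerivAt hK i x).mul (Dx_hasDerivAt (Dx_smooth i hf) i t x)))
      exact this.congr_deriv (by simp [d])
    have iP := slice_int (t := t) hC cP (Pz t)
    have iQ := slice_int (t := t) hC cQ (Qz t)
    rw [← integral_const_mul, ← integral_const_mul,
      ← integral_sub (iP.const_mul _) (iQ.const_mul _)]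
    apply integral_sub_div_le hC (G := fun x => F' (t, x)) (V0 := V 0) (V1 := V 1)
      (d0 := d 0) (d1 := d 1) (by fun_prop) (hF'z t ht)
      (by fun_prop) (by fun_prop) (by fun_prop) (by fun_prop) (i0 0) (i0 1)
      (by intro x hx; simp [V, hχC x hx]) (by intro x hx; simp [V, hχC x hx])
      ((iP.const_mul _).sub (iQ.const_mul _))
    intro x
    by_cases hx : x ∈ C
    · have h3 := caccio_ineq (e := (T - t) * χ x) (p := Dt f (t, x)) (k := -K x) (s := T - t)
        (f := f (t, x)) (f0 := Dx 0 f (t, x)) (f1 := Dx 1 f (t, x)) (m := m)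
        (by linarith [hKC x hx]) (pow_le_pow_left₀ (by linarith [ht.2]) (by linarith [ht.1]) 2)
        (hΛ x hx)
      refine h3.trans (le_of_eq ?_)
      simp only [F', d]
      rw [hS t x ht.1]
      ring
    · have hm0 : m ≠ 0 := by omega
      simp [P, Q, F', d, hχC x hx, hm0]
  have IP := intervalInt_int hT.le hC cP (fun t _ => Pz t)
  have IQ := intervalInt_int hT.le hC cQ (fun t _ => Qz t)
  have IF := intervalInt_int hT.le hC cF' hF'z
  have hfin := intervalIntegral.integral_mono_on hT.le
    ((IP.const_mul (1 / 2)).sub (IQ.const_mul (2 * (m + 1) ^ 2 * Λ))) IF hlow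
  rw [hz, intervalIntegral.integral_sub (IP.const_mul (1 / 2))
    (IQ.const_mul (2 * (m + 1) ^ 2 * Λ)), intervalIntegral.integral_const_mul,
    intervalIntegral.integral_const_mul] at hfin
  change (∫ t in (0 : ℝ)..T, ∫ x, P (t, x)) ≤ 4 * (m + 1) ^ 2 * Λ *
    ∫ t in (0 : ℝ)..T, ∫ x, Q (t, x)
  linarith

/-- Iterated time derivatives. -/
noncomputable def W (f : ℝ × E2 → ℝ) : ℕ → ℝ × E2 → ℝ
  | 0 => f
  | n + 1 => Dt (W f n)

lemma W_smooth {f : ℝ × E2 → ℝ} (hf : ContDiff ℝ (⊤ : ℕ∞) f) (n : ℕ) :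
    ContDiff ℝ (⊤ : ℕ∞) (W f n) := by
  induction n with
  | zero => exact hf
  | succ n ih => exact Dt_smooth ih

lemma W_sol {K : E2 → ℝ} {f : ℝ × E2 → ℝ} (hf : ContDiff ℝ (⊤ : ℕ∞) f) (hS : Sol K f) (n : ℕ) :
    Sol K (W f n) := by
  induction n with
  | zero => exact hS
  | succ n ih => exact Sol_Dt (W_smooth hf n) ih

lemma W_zero {K : E2 → ℝ} {f : ℝ × E2 → ℝ} (hf : ContDiff ℝ (⊤ : ℕ∞) f) (hS : Sol K f)
    {U : Set E2} (hU : IsOpen U) (h0 : ∀ x ∈ U, f (0, x) = 0) (h1 : ∀ x ∈ U, Dt f (0, x) = 0)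
    (n : ℕ) : (∀ x ∈ U, W f n (0, x) = 0) ∧ (∀ x ∈ U, W f (n + 1) (0, x) = 0) := by
  induction n with
  | zero => exact ⟨h0, h1⟩
  | succ n ih =>
    refine ⟨ih.2, fun x hx => ?_⟩
    have hs := W_smooth hf n
    have d1 := fun i => Dx_zero_of_open hs hU ih.1 i
    have d2 := fun i => Dx_zero_of_open (Dx_smooth i hs) hU (d1 i) i
    change Dt (Dt (W f n)) (0, x) = 0
    rw [W_sol hf hS n 0 x le_rfl, d1 0 x hx, d1 1 x hx, d2 0 x hx, d2 1 x hx]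
    simp

lemma caccio_iter {K : E2 → ℝ} (hK : ContDiff ℝ 1 K) {f : ℝ × E2 → ℝ}
    (hf : ContDiff ℝ (⊤ : ℕ∞) f)
    (hS : Sol K f) {χ : E2 → ℝ} (hχ : ContDiff ℝ 1 χ) {C : Set E2} (hC : IsCompact C)
    (hχC : ∀ x, x ∉ C → χ x = 0) (hKC : ∀ x ∈ C, K x ≤ 0) (h0 : ∀ n, ∀ x ∈ C, W f n (0, x) = 0)
    {T L : ℝ} (hT : 0 < T)
    (hL : ∀ x ∈ C, 4 * (χ x ^ 2 + (-K x) * T ^ 2 * (Ds 0 χ x ^ 2 + Ds 1 χ x ^ 2)) ≤ L ^ 2)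
    (n : ℕ) :
    (∫ t in (0 : ℝ)..T, ∫ x, ((T - t) * χ x) ^ (2 * n + 2) * W f n (t, x) ^ 2) ≤
      (L ^ n * (n + 1).factorial) ^ 2 *
      ∫ t in (0 : ℝ)..T, ∫ x, ((T - t) * χ x) ^ 2 * f (t, x) ^ 2 := by
  induction n with
  | zero => simp [W]
  | succ n ih =>
    have := caccio hK (W_smooth hf n) (W_sol hf hS n) hχ hC hχC hKC (h0 n) (Λ := L ^ 2 / 4) hT
      (fun x hx => by linarith [hL x hx]) (n + 1) (by omega)
    refine this.trans ?_
    refine (mul_le_mul_of_nonneg_left ih (by positivity)).trans (le_of_eq ?_)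
    rw [Nat.factorial_succ (n + 1)]
    push_cast
    ring

lemma fact_bound (n k : ℕ) : ((n + k + 2).factorial : ℝ) ≤
    2 ^ (n + k + 2) * (n + 2).factorial * k.factorial := by
  have h := Nat.add_choose_mul_factorial_mul_factorial (n + 2) k
  have h2 : (n + 2 + k).choose (n + 2) ≤ 2 ^ (n + 2 + k) := Nat.choose_le_two_pow _ _
  have e : n + k + 2 = n + 2 + k := by ring
  rw [e, ← h]
  push_cast
  gcongr
  rw [Nat.choose_symm_add] at h2
  exact_mod_cast h2

lemma scalar_step {g : ℕ → ℝ → ℝ} {T A L : ℝ} (hA : 0 ≤ A) (hL : 0 < L)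
    (hc : ∀ n, ContinuousOn (g n) (Icc 0 T))
    (hftc : ∀ n s t, 0 ≤ s → s ≤ t → t ≤ T → g n t - g n s = ∫ r in s..t, g (n + 1) r)
    (hb : ∀ n, ∀ t ∈ Icc 0 T, |g n t| ≤ A * L ^ n * (n + 2).factorial)
    {s : ℝ} (hs : 0 ≤ s) (h0 : ∀ n, g n s = 0) :
    ∀ n t, s ≤ t → t ≤ T → t - s ≤ 1 / (4 * L) → g n t = 0 := by
  have claim : ∀ k n t, s ≤ t → t ≤ T →
      |g n t| ≤ A * L ^ (n + k) * (n + k + 2).factorial * ((t - s) ^ k / k.factorial) := by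
    intro k
    induction k with
    | zero => intro n t h1 h2; simpa using hb n t ⟨hs.trans h1, h2⟩
    | succ k ih =>
      intro n t h1 h2
      have e := hftc n s t hs h1 h2
      rw [h0 n, sub_zero] at e
      rw [e]
      have b1 : ∀ r ∈ Ioc s t, ‖g (n + 1) r‖ ≤ A * L ^ (n + 1 + k) * (n + 1 + k + 2).factorial *
          ((r - s) ^ k / k.factorial) := fun r hr => ih (n + 1) r hr.1.le (hr.2.trans h2)
      have b2 := intervalIntegral.norm_integral_le_of_norm_le (μ := volume) h1
        (Filter.Eventually.of_forall b1)
        (by apply Continuous.intervalIntegrable; fun_prop)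
      rw [Real.norm_eq_abs] at b2
      refine b2.trans (le_of_eq ?_)
      rw [intervalIntegral.integral_const_mul, intervalIntegral.integral_div]
      have e3 : ∫ r in s..t, (r - s) ^ k = (t - s) ^ (k + 1) / (k + 1) := by
        rw [intervalIntegral.integral_comp_sub_right (fun r => r ^ k) s]
        simp
      rw [e3, Nat.factorial_succ k, show n + 1 + k = n + (k + 1) by ring]
      push_cast
      field_simp
  intro n t h1 h2 h3
  have lim : Filter.Tendsto (fun k : ℕ => A * L ^ n * 2 ^ (n + 2) * (n + 2).factorial *
      (1 / 2 : ℝ) ^ k) Filter.atTop (nhds 0) := by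
    have := (tendsto_pow_atTop_nhds_zero_of_lt_one (r := (1 / 2 : ℝ)) (by norm_num)
      (by norm_num)).const_mul (A * L ^ n * 2 ^ (n + 2) * (n + 2).factorial)
    simpa using this
  have : |g n t| ≤ 0 := by
    apply ge_of_tendsto' lim
    intro k
    refine (claim k n t h1 h2).trans ?_
    have hts : 0 ≤ t - s := by linarith
    calc A * L ^ (n + k) * (n + k + 2).factorial * ((t - s) ^ k / k.factorial)
        ≤ A * L ^ (n + k) * (2 ^ (n + k + 2) * (n + 2).factorial * k.factorial) *
          ((1 / (4 * L)) ^ k / k.factorial) := by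
          gcongr
          exact fact_bound n k
      _ = A * L ^ n * 2 ^ (n + 2) * (n + 2).factorial * (L * 2 * (1 / (4 * L))) ^ k := by
          have : (k.factorial : ℝ) ≠ 0 := by positivity
          rw [mul_pow, mul_pow]
          field_simp
          ring
      _ = _ := by
          congr 2
          field_simp
          norm_num
  exact abs_nonpos_iff.1 this

lemma scalar_zero {g : ℕ → ℝ → ℝ} {T A L : ℝ} (hA : 0 ≤ A) (hL : 0 < L)
    (hc : ∀ n, ContinuousOn (g n) (Icc 0 T))
    (hftc : ∀ n s t, 0 ≤ s → s ≤ t → t ≤ T → g n t - g n s = ∫ r in s..t, g (n + 1) r)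
    (hb : ∀ n, ∀ t ∈ Icc 0 T, |g n t| ≤ A * L ^ n * (n + 2).factorial)
    (h0 : ∀ n, g n 0 = 0) : ∀ n, ∀ t ∈ Icc 0 T, g n t = 0 := by
  have hh : 0 < 1 / (4 * L) := by positivity
  set h := 1 / (4 * L) with hdef
  have claim : ∀ k : ℕ, ∀ n, ∀ t ∈ Icc 0 T, t ≤ k * h → g n t = 0 := by
    intro k
    induction k with
    | zero =>
      intro n t ht h1
      have : t = 0 := le_antisymm (by simpa using h1) ht.1
      rw [this, h0]
    | succ k ih =>
      intro n t ht h1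
      rcases le_total t (k * h) with h2 | h2
      · exact ih n t ht h2
      · have hk : 0 ≤ k * h := by positivity
        refine scalar_step hA hL hc hftc hb hk
          (fun n => ih n _ ⟨hk, h2.trans ht.2⟩ le_rfl) n t h2 ht.2 ?_
        push_cast at h1
        linarith
  intro n t ht
  obtain ⟨k, hk⟩ := exists_nat_ge (t / h)
  exact claim k n t ht ((div_le_iff₀ hh).1 hk)

set_option maxHeartbeats 1000000 in
lemma elliptic {K : E2 → ℝ} (hK : ContDiff ℝ 1 K) {f : ℝ × E2 → ℝ}
    (hf : ContDiff ℝ (⊤ : ℕ∞) f) (hS : Sol K f) {z : E2} {R : ℝ} (hR : 0 < R)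
    (hKC : ∀ x ∈ Metric.closedBall z R, K x ≤ 0)
    (h0 : ∀ n, ∀ x ∈ Metric.closedBall z R, W f n (0, x) = 0) {T : ℝ} (hT : 0 < T) :
    f (T, z) = 0 := by
  let χ : ContDiffBump z := ⟨R / 2, R, by linarith, by linarith⟩
  let χ2 : ContDiffBump z := ⟨R / 4, R / 2, by linarith, by linarith⟩
  have hχ : ContDiff ℝ 1 (χ : E2 → ℝ) := χ.contDiff
  have hχ0 := hχ.continuous
  have hχ20 : Continuous (χ2 : E2 → ℝ) := χ2.continuous
  have hχd0 := Ds_cont hχ 0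
  have hχd1 := Ds_cont hχ 1
  have hK0 := hK.continuous
  have cf := hf.continuous
  have hC : IsCompact (Metric.closedBall z R) := isCompact_closedBall z R
  have hD : IsCompact (Metric.closedBall z (R / 2)) := isCompact_closedBall z _
  have hχC : ∀ x, x ∉ Metric.closedBall z R → χ x = 0 := by
    intro x hx
    apply χ.zero_of_le_dist
    simp only [Metric.mem_closedBall, not_le] at hx
    exact hx.le
  have hχ2D : ∀ x, x ∉ Metric.closedBall z (R / 2) → χ2 x = 0 := by
    intro x hx
    apply χ2.zero_of_le_dist
    simp only [Metric.mem_closedBall, not_le] at hx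
    exact hx.le
  have hχ1 : ∀ x ∈ Metric.closedBall z (R / 2), χ x = 1 := fun x hx =>
    χ.one_of_mem_closedBall hx
  set T1 := T + 1 with hT1
  have hT1p : 0 < T1 := by linarith
  obtain ⟨B, hB⟩ := hC.exists_bound_of_continuousOn
    (f := fun x => 4 * (χ x ^ 2 + (-K x) * T1 ^ 2 * (Ds 0 χ x ^ 2 + Ds 1 χ x ^ 2)))
    (Continuous.continuousOn (by fun_prop))
  set L := |B| + 1 with hLdef
  have hLp : 0 < L := by positivity
  have hL : ∀ x ∈ Metric.closedBall z R,
      4 * (χ x ^ 2 + (-K x) * T1 ^ 2 * (Ds 0 χ x ^ 2 + Ds 1 χ x ^ 2)) ≤ L ^ 2 := by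
    intro x hx
    have h1 := (le_abs_self _).trans (hB x hx)
    have h2 := le_abs_self B
    have h3 := abs_nonneg B
    refine h1.trans ?_
    rw [hLdef]
    nlinarith
  have hI := caccio_iter hK hf hS hχ hC hχC hKC h0 hT1p hL
  set I0 := ∫ t in (0 : ℝ)..T1, ∫ x, ((T1 - t) * χ x) ^ 2 * f (t, x) ^ 2 with hI0
  have hI0n : 0 ≤ I0 := by
    apply intervalIntegral.integral_nonneg hT1p.le
    intro t _
    apply integral_nonneg
    intro x
    positivity
  let ρ : E2 → ℝ := fun x => χ2 x * f (T, x)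
  have cρ : Continuous ρ := by fun_prop
  have hρD : ∀ x, x ∉ Metric.closedBall z (R / 2) → ρ x = 0 := by
    intro x hx; simp [ρ, hχ2D x hx]
  obtain ⟨P, hP⟩ := hD.exists_bound_of_continuousOn cρ.continuousOn
  have hPn : 0 ≤ P := (norm_nonneg _).trans (hP z (Metric.mem_closedBall_self (by linarith)))
  have iρ : Integrable (fun x => |ρ x|) :=
    (cρ.integrable_of_hasCompactSupport (HasCompactSupport.intro hD hρD)).abs
  set N1 := ∫ x, |ρ x| with hN1
  have hN1n : 0 ≤ N1 := integral_nonneg (fun x => abs_nonneg _)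
  let G : ℕ → ℝ × E2 → ℝ := fun n p => ρ p.2 * W f n p
  have cW := fun n => (W_smooth hf n).continuous
  have cG : ∀ n, Continuous (G n) := by
    intro n
    have := cW n
    fun_prop
  have Gz : ∀ n (t : ℝ), ∀ x, x ∉ Metric.closedBall z (R / 2) → G n (t, x) = 0 := by
    intro n t x hx; simp [G, hρD x hx]
  let g : ℕ → ℝ → ℝ := fun n t => ∫ x, G n (t, x)
  have gc : ∀ n, ContinuousOn (g n) (Icc 0 T) := fun n =>
    contOn_int hD (cG n) (fun t _ => Gz n t)
  have gint : ∀ n s t, 0 ≤ s → s ≤ t → t ≤ T → g n t - g n s = ∫ r in s..t, g (n + 1) r := by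
    intro n s t _ hst _
    rcases hst.eq_or_lt with h | h
    · subst h; simp
    · apply ftc_int h hD (cG n) (cG (n + 1)) _ (fun t _ => Gz n t)
      intro r _ x
      exact (Dt_hasDerivAt (W_smooth hf n) r x).const_mul (ρ x)
  have g0 : ∀ n, g n 0 = 0 := by
    intro n
    have : ∀ x, G n (0, x) = 0 := by
      intro x
      by_cases hx : x ∈ Metric.closedBall z (R / 2)
      · simp [G, h0 n x (Metric.closedBall_subset_closedBall (by linarith) hx)]
      · exact Gz n 0 x hx
    simp [g, this]
  have gb : ∀ n, ∀ t ∈ Icc 0 T, |g n t| ≤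
      (1 / 2 * (N1 * T1 + P * I0) * L) * L ^ n * (n + 2).factorial := by
    intro n t ht
    set s : ℝ := L ^ (n + 1) * (n + 1 + 1).factorial with hs
    have hsp : 0 < s := by positivity
    let J : ℝ × E2 → ℝ := fun p => ((T1 - p.1) * χ p.2) ^ (2 * (n + 1) + 2) * W f (n + 1) p ^ 2
    have cJ : Continuous J := by
      have := cW (n + 1)
      fun_prop
    have Jz : ∀ (t : ℝ), ∀ x, x ∉ Metric.closedBall z R → J (t, x) = 0 := by
      intro t x hx; simp [J, hχC x hx]
    have Jn : ∀ p, 0 ≤ J p := by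
      intro p
      simp only [J]
      rw [show 2 * (n + 1) + 2 = 2 * (n + 2) by ring, pow_mul]
      positivity
    have IJ := intervalInt_int hT1p.le hC cJ (fun t _ => Jz t)
    have hJ : ∫ r in (0 : ℝ)..T1, ∫ x, J (r, x) ≤ s ^ 2 * I0 := hI (n + 1)
    have hpt : ∀ r ∈ Icc 0 T, |g (n + 1) r| ≤ 1 / 2 * s * N1 + P / (2 * s) * ∫ x, J (r, x) := by
      intro r hr
      have iJ := slice_int (t := r) hC cJ (Jz r)
      have iG := slice_int (t := r) hD (cG (n + 1)) (Gz (n + 1) r)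
      rw [hN1, ← integral_const_mul, ← integral_const_mul,
        ← integral_add (iρ.const_mul _) (iJ.const_mul _)]
      refine (abs_integral_le_integral_abs).trans ?_
      apply integral_mono iG.abs ((iρ.const_mul _).add (iJ.const_mul _))
      intro x
      simp only [Pi.add_apply]
      by_cases hx : x ∈ Metric.closedBall z (R / 2)
      · have hη : 1 ≤ ((T1 - r) * χ x) ^ (2 * (n + 1) + 2) := by
          rw [hχ1 x hx]
          apply one_le_pow₀
          linarith [hr.2]
        have hJ1 : W f (n + 1) (r, x) ^ 2 ≤ J (r, x) := by
          simp only [J]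
          exact le_mul_of_one_le_left (sq_nonneg _) hη
        have hPx : |ρ x| ≤ P := hP x hx
        simp only [G]
        rw [abs_mul]
        set w := |W f (n + 1) (r, x)| with hw
        have hw2 : w ^ 2 ≤ J (r, x) := by rw [hw, sq_abs]; exact hJ1
        have h4 : w ≤ 1 / 2 * s + 1 / (2 * s) * w ^ 2 := by
          have : 1 / 2 * s + 1 / (2 * s) * w ^ 2 - w = (s - w) ^ 2 / (2 * s) := by
            field_simp; ring
          have h5 : 0 ≤ (s - w) ^ 2 / (2 * s) := by positivity
          linarith
        calc |ρ x| * w ≤ |ρ x| * (1 / 2 * s + 1 / (2 * s) * w ^ 2) := by gcongr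
          _ = 1 / 2 * s * |ρ x| + |ρ x| / (2 * s) * w ^ 2 := by ring
          _ ≤ 1 / 2 * s * |ρ x| + P / (2 * s) * J (r, x) := by
            gcongr
      · have := Jn (r, x)
        rw [Gz _ r x hx, hρD x hx]
        simp only [abs_zero, mul_zero, zero_add]
        positivity
    have e := gint n 0 t le_rfl ht.1 ht.2
    rw [g0 n, sub_zero] at e
    have Ih : IntervalIntegrable (fun r => 1 / 2 * s * N1 + P / (2 * s) * ∫ x, J (r, x))
        volume 0 T1 := intervalIntegrable_const.add (IJ.const_mul _)
    have htT1 : t ≤ T1 := by linarith [ht.2]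
    have b2 := intervalIntegral.norm_integral_le_of_norm_le ht.1 (f := g (n + 1))
        (Filter.Eventually.of_forall (fun r (hr : r ∈ Ioc 0 t) =>
          hpt r ⟨hr.1.le, hr.2.trans ht.2⟩))
        (Ih.mono_set (by rw [uIcc_of_le ht.1, uIcc_of_le hT1p.le]; exact Icc_subset_Icc le_rfl htT1))
    have b3 : ∫ r in (0 : ℝ)..t, (1 / 2 * s * N1 + P / (2 * s) * ∫ x, J (r, x)) ≤
        ∫ r in (0 : ℝ)..T1, (1 / 2 * s * N1 + P / (2 * s) * ∫ x, J (r, x)) := by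
      apply intervalIntegral.integral_mono_interval le_rfl ht.1 htT1 _ Ih
      refine Filter.Eventually.of_forall (fun r => ?_)
      have : 0 ≤ ∫ x, J (r, x) := integral_nonneg (fun x => Jn _)
      simp only [Pi.zero_apply]
      positivity
    rw [intervalIntegral.integral_add intervalIntegrable_const (IJ.const_mul _),
      intervalIntegral.integral_const, intervalIntegral.integral_const_mul] at b3
    rw [e]
    rw [Real.norm_eq_abs] at b2
    refine b2.trans (b3.trans ?_)
    have h6 : P / (2 * s) * ∫ r in (0 : ℝ)..T1, ∫ x, J (r, x) ≤ P / (2 * s) * (s ^ 2 * I0) := by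
      gcongr
    have h7 : P / (2 * s) * (s ^ 2 * I0) = 1 / 2 * P * I0 * s := by
      field_simp
    have h8 : 1 / 2 * (N1 * T1 + P * I0) * L * L ^ n * (n + 2).factorial =
      1 / 2 * (N1 * T1 + P * I0) * s := by rw [hs]; ring
    rw [h8]
    simp only [sub_zero, smul_eq_mul]
    linarith
  have hz := scalar_zero (by positivity) hLp gc gint gb g0 0 T ⟨hT.le, le_rfl⟩
  by_contra hne
  have hχ2z : χ2 z = 1 := χ2.one_of_mem_closedBall (Metric.mem_closedBall_self χ2.rIn_pos.le)
  have := Continuous.integral_pos_of_hasCompactSupport_nonneg_nonzero (μ := volume)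
    (f := fun x => G 0 (T, x)) (x := z) (by have := cG 0; fun_prop)
    (HasCompactSupport.intro hD (Gz 0 T))
    (by
      intro x
      have h1 : 0 ≤ χ2 x := χ2.nonneg
      simp only [G, ρ, W, Pi.zero_apply]
      rw [mul_assoc]
      exact mul_nonneg h1 (mul_self_nonneg _))
    (by simp [G, ρ, W, hχ2z, hne])
  exact this.ne' hz

lemma gradient_coord (g : E2 → ℝ) (x : E2) (i : Fin 2) : gradient g x i = Ds i g x := by
  have h : ⟪gradient g x, ee i⟫ = fderiv ℝ g x (ee i) := by
    rw [gradient]; exact InnerProductSpace.toDual_symm_apply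
  rw [ee, EuclideanSpace.inner_single_right] at h
  simpa [Ds, ee] using h

lemma slice_smooth {f : ℝ × E2 → ℝ} (hf : ContDiff ℝ (⊤ : ℕ∞) f) (t : ℝ) :
    ContDiff ℝ (⊤ : ℕ∞) (fun x => f (t, x)) :=
  hf.comp (contDiff_const.prodMk contDiff_id)

lemma Ds_slice {f : ℝ × E2 → ℝ} (hf : ContDiff ℝ (⊤ : ℕ∞) f) (t : ℝ) (i : Fin 2) (x : E2) :
    Ds i (fun x => f (t, x)) x = Dx i f (t, x) :=
  (Ds_hasDerivAt ((slice_smooth hf t).of_le (by exact_mod_cast le_top)) i x).unique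
    (Dx_hasDerivAt hf i t x)

lemma div2_eq {K : E2 → ℝ} (hK : ContDiff ℝ 1 K) {f : ℝ × E2 → ℝ}
    (hf : ContDiff ℝ (⊤ : ℕ∞) f) (t : ℝ) (x : E2) :
    div2 (fun y => K y • gradient (fun x => f (t, x)) y) x =
    (Ds 0 K x * Dx 0 f (t, x) + K x * Dx 0 (Dx 0 f) (t, x)) +
    (Ds 1 K x * Dx 1 f (t, x) + K x * Dx 1 (Dx 1 f) (t, x)) := by
  have hg : Differentiable ℝ (fun y => gradient (fun x => f (t, x)) y) := by
    have h1 : Differentiable ℝ (fderiv ℝ (fun x => f (t, x))) :=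
      ((slice_smooth hf t).fderiv_right (m := (⊤ : ℕ∞)) (by simp)).differentiable (by simp)
    exact (InnerProductSpace.toDual ℝ E2).symm.toContinuousLinearEquiv.differentiable.comp h1
  have hF : Differentiable ℝ (fun y => K y • gradient (fun x => f (t, x)) y) :=
    (hK.differentiable (by simp)).smul hg
  have key : ∀ i : Fin 2, fderiv ℝ (fun y => K y • gradient (fun x => f (t, x)) y) x (ee i) i =
      Ds i K x * Dx i f (t, x) + K x * Dx i (Dx i f) (t, x) := by
    intro i
    have h1 : HasFDerivAt (fun y => K y • gradient (fun x => f (t, x)) y)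
      (fderiv ℝ (fun y => K y • gradient (fun x => f (t, x)) y) x) (x + (0 : ℝ) • ee i) := by
      simpa using (hF x).hasFDerivAt
    have h2 := h1.comp_hasDerivAt (0 : ℝ) (line_hasDerivAt x (ee i))
    have h3 := (EuclideanSpace.proj i : E2 →L[ℝ] ℝ).hasFDerivAt.comp_hasDerivAt
      (0 : ℝ) h2
    have h4 := (Ds_hasDerivAt hK i x).mul (Dx_hasDerivAt (Dx_smooth i hf) i t x)
    have h5 : (fun s : ℝ => (K (x + s • ee i)) * Dx i f (t, x + s • ee i)) =
      (EuclideanSpace.proj i : E2 →L[ℝ] ℝ) ∘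
      ((fun y => K y • gradient (fun x => f (t, x)) y) ∘ fun s : ℝ => x + s • ee i) := by
      funext s
      simp [gradient_coord, Ds_slice hf]
    rw [← h5] at h3
    have := h3.unique h4
    simpa using this
  rw [div2, Fin.sum_univ_two]
  exact congrArg₂ (· + ·) (key 0) (key 1)

lemma E2_inner (x y : E2) : ⟪x, y⟫ = x 0 * y 0 + x 1 * y 1 := by
  simp [PiLp.inner_apply, Fin.sum_univ_two, mul_comm]

/-- Finite propagation speed, without any sign assumption on `K`. -/
lemma finite_speed {K : E2 → ℝ} (hK : ContDiff ℝ 1 K) {f : ℝ × E2 → ℝ}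
    (hf : ContDiff ℝ (⊤ : ℕ∞) f) (hS : Sol K f) {c R : ℝ} (hc : 0 < c) (hKc : ∀ x, |K x| ≤ c ^ 2)
    (h0 : ∀ x, R < ‖x‖ → f (0, x) = 0) (h1 : ∀ x, R < ‖x‖ → Dt f (0, x) = 0)
    (t : ℝ) (ht : 0 ≤ t) (x : E2) (hx : R + c * t < ‖x‖) : f (t, x) = 0 ∧ Dt f (t, x) = 0 := by
  have hU : IsOpen {y : E2 | R < ‖y‖} := isOpen_lt continuous_const continuous_norm
  have hW := fun n => (W_zero hf hS hU h0 h1 n).1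
  have hU2 : IsOpen ({y : E2 | R < ‖y‖} ∩ {y | K y < 0}) :=
    hU.inter (isOpen_lt hK.continuous continuous_const)
  have hell : ∀ t, 0 ≤ t → ∀ y ∈ {y : E2 | R < ‖y‖} ∩ {y | K y < 0}, f (t, y) = 0 := by
    intro t ht y hy
    rcases ht.eq_or_lt with h | h
    · subst h; exact h0 y hy.1
    obtain ⟨r, hr, hrs⟩ := Metric.nhds_basis_closedBall.mem_iff.1 (hU2.mem_nhds hy)
    exact elliptic hK hf hS hr (fun z hz => le_of_lt (hrs hz).2) (fun n z hz => hW n z (hrs hz).1) h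
  have hpos : ∀ t x, 0 ≤ t → R < ‖x‖ →
      0 ≤ K x * (Dx 0 f (t, x) ^ 2 + Dx 1 f (t, x) ^ 2) := by
    intro t x ht hx
    rcases le_or_gt 0 (K x) with h | h
    · positivity
    · have d := fun i => Dx_zero_of_open hf hU2 (hell t ht) i x ⟨hx, h⟩
      simp [d]
  have hDt : ∀ s, 0 ≤ s → s ≤ t → Dt f (s, x) = 0 := by
    intro s hs hst
    have := mul_le_mul_of_nonneg_left hst hc.le
    exact cone hK hf hS hc hKc h0 h1 hpos hs (by linarith)
  refine ⟨?_, hDt t ht le_rfl⟩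
  have cDt := (Dt_smooth hf).continuous
  have e : ∫ s in (0 : ℝ)..t, Dt f (s, x) = f (t, x) - f (0, x) := by
    apply intervalIntegral.integral_eq_sub_of_hasDerivAt
    · intro s _; exact Dt_hasDerivAt hf s x
    · apply Continuous.intervalIntegrable; fun_prop
  have e2 : ∫ s in (0 : ℝ)..t, Dt f (s, x) = ∫ s in (0 : ℝ)..t, (0 : ℝ) := by
    apply intervalIntegral.integral_congr
    intro s hs
    rw [uIcc_of_le ht] at hs
    exact hDt s hs.1 hs.2
  rw [e2, h0 x (by nlinarith [mul_nonneg hc.le ht])] at e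
  simpa using e.symm

set_option maxHeartbeats 1000000 in
/-- The Morawetz identity in coordinates. -/
lemma morawetz {K : E2 → ℝ} (hK : ContDiff ℝ 1 K) {f : ℝ × E2 → ℝ}
    (hf : ContDiff ℝ (⊤ : ℕ∞) f) (hS : Sol K f) {C : Set E2} (hC : IsCompact C) {T : ℝ} (hT : 0 < T)
    (hz : ∀ t ∈ Icc 0 T, ∀ x, x ∉ C → f (t, x) = 0)
    (hzt : ∀ t ∈ Icc 0 T, ∀ x, x ∉ C → Dt f (t, x) = 0) :
    (T * (1 / 2 * ((∫ x, Dt f (T, x) ^ 2) +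
        ∫ x, K x * (Dx 0 f (T, x) ^ 2 + Dx 1 f (T, x) ^ 2))) +
      1 / 2 * (∫ x, Dt f (T, x) * f (T, x)) +
      (∫ x, Dt f (T, x) * (x 0 * Dx 0 f (T, x) + x 1 * Dx 1 f (T, x)))) =
    (1 / 2 * (∫ x, Dt f (0, x) * f (0, x)) +
      (∫ x, Dt f (0, x) * (x 0 * Dx 0 f (0, x) + x 1 * Dx 1 f (0, x)))) +
    1 / 2 * ∫ s in (0 : ℝ)..T, ∫ x, (x 0 * Ds 0 K x + x 1 * Ds 1 K x) *
      (Dx 0 f (s, x) ^ 2 + Dx 1 f (s, x) ^ 2) := by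
  have hK0 := hK.continuous
  have hKd0 := Ds_cont hK 0
  have hKd1 := Ds_cont hK 1
  have cf := hf.continuous
  have ct := (Dt_smooth hf).continuous
  have ctt := (Dt_smooth (Dt_smooth hf)).continuous
  have cx0 := (Dx_smooth 0 hf).continuous
  have cx1 := (Dx_smooth 1 hf).continuous
  have cxx := fun i j => (Dx_smooth i (Dx_smooth j hf)).continuous
  have cx00 := cxx 0 0
  have cx01 := cxx 0 1
  have cx10 := cxx 1 0
  have cx11 := cxx 1 1
  have ctx0 := (Dx_smooth 0 (Dt_smooth hf)).continuous
  have ctx1 := (Dx_smooth 1 (Dt_smooth hf)).continuous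
  have hsym : Dx 1 (Dx 0 f) = Dx 0 (Dx 1 f) := DD_comm hf
  have hzx : ∀ t ∈ Icc 0 T, ∀ i x, x ∉ C → Dx i f (t, x) = 0 := by
    intro t ht i x hx
    exact Dx_zero_of_open hf hC.isClosed.isOpen_compl (fun y hy => hz t ht y hy) i x hx
  let F1 : ℝ × E2 → ℝ := fun p => Dt f p ^ 2
  let F2 : ℝ × E2 → ℝ := fun p => K p.2 * (Dx 0 f p ^ 2 + Dx 1 f p ^ 2)
  let F3 : ℝ × E2 → ℝ := fun p => Dt f p * f p
  let F4 : ℝ × E2 → ℝ := fun p => Dt f p * (p.2 0 * Dx 0 f p + p.2 1 * Dx 1 f p)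
  let F : ℝ × E2 → ℝ := fun p => p.1 * (1 / 2 * (F1 p + F2 p)) + 1 / 2 * F3 p + F4 p
  let F' : ℝ × E2 → ℝ := fun p => 1 / 2 * (F1 p + F2 p) +
    p.1 * (Dt f p * Dt (Dt f) p + K p.2 * (Dx 0 f p * Dx 0 (Dt f) p + Dx 1 f p * Dx 1 (Dt f) p)) +
    1 / 2 * (Dt (Dt f) p * f p + Dt f p ^ 2) +
    (Dt (Dt f) p * (p.2 0 * Dx 0 f p + p.2 1 * Dx 1 f p) +
      Dt f p * (p.2 0 * Dx 0 (Dt f) p + p.2 1 * Dx 1 (Dt f) p))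
  have c1 : Continuous F1 := by fun_prop
  have c2 : Continuous F2 := by fun_prop
  have c3 : Continuous F3 := by fun_prop
  have c4 : Continuous F4 := by fun_prop
  have cF : Continuous F := by fun_prop
  have cF' : Continuous F' := by fun_prop
  have z1 : ∀ t ∈ Icc 0 T, ∀ x, x ∉ C → F1 (t, x) = 0 := by
    intro t ht x hx; simp [F1, hzt t ht x hx]
  have z2 : ∀ t ∈ Icc 0 T, ∀ x, x ∉ C → F2 (t, x) = 0 := by
    intro t ht x hx; simp [F2, hzx t ht _ x hx]
  have z3 : ∀ t ∈ Icc 0 T, ∀ x, x ∉ C → F3 (t, x) = 0 := by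
    intro t ht x hx; simp [F3, hzt t ht x hx]
  have z4 : ∀ t ∈ Icc 0 T, ∀ x, x ∉ C → F4 (t, x) = 0 := by
    intro t ht x hx; simp [F4, hzt t ht x hx]
  have zF : ∀ t ∈ Icc 0 T, ∀ x, x ∉ C → F (t, x) = 0 := by
    intro t ht x hx
    simp only [F]
    rw [z1 t ht x hx, z2 t ht x hx, z3 t ht x hx, z4 t ht x hx]; simp
  have hd : ∀ t ∈ Ioo (0 : ℝ) T, ∀ x, HasDerivAt (fun s => F (s, x)) (F' (t, x)) t := by
    intro t _ x
    have e0 := Dt_hasDerivAt (Dx_smooth 0 hf) t x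
    have e1 := Dt_hasDerivAt (Dx_smooth 1 hf) t x
    rw [Dt_Dx _ hf] at e0 e1
    have et := Dt_hasDerivAt hf t x
    have ett := Dt_hasDerivAt (Dt_smooth hf) t x
    have := (((hasDerivAt_id t).mul (((ett.pow 2).add
      (((e0.pow 2).add (e1.pow 2)).const_mul (K x))).const_mul (1 / 2))).add
      ((ett.mul et).const_mul (1 / 2))).add (ett.mul ((e0.const_mul (x 0)).add (e1.const_mul (x 1))))
    refine this.congr_deriv ?_
    simp only [F', F1, F2, Nat.cast_ofNat, Nat.reduceSub, pow_one, Pi.add_apply, Pi.pow_apply,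
      Pi.mul_apply, id]
    ring
  have hftc := ftc_int hT hC cF cF' hd zF
  have zF' := deriv_zero_off hT cF' hd zF
  have hsplit : ∀ t ∈ Icc 0 T, ∫ x, F (t, x) =
      t * (1 / 2 * ((∫ x, F1 (t, x)) + ∫ x, F2 (t, x))) + 1 / 2 * (∫ x, F3 (t, x)) +
        ∫ x, F4 (t, x) := by
    intro t ht
    have i1 := slice_int hC c1 (z1 t ht)
    have i2 := slice_int hC c2 (z2 t ht)
    have i3 := slice_int hC c3 (z3 t ht)
    have i4 := slice_int hC c4 (z4 t ht)
    have i12 : Integrable (fun x => F1 (t, x) + F2 (t, x)) := i1.add i2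
    have j1 : Integrable (fun x => t * (1 / 2 * (F1 (t, x) + F2 (t, x)))) :=
      (i12.const_mul _).const_mul _
    have j2 : Integrable (fun x => t * (1 / 2 * (F1 (t, x) + F2 (t, x))) + 1 / 2 * F3 (t, x)) :=
      j1.add (i3.const_mul _)
    simp only [F]
    rw [integral_add j2 i4, integral_add j1 (i3.const_mul _), integral_const_mul,
      integral_const_mul, integral_const_mul, integral_add i1 i2]
  have hslice : ∀ t ∈ Icc 0 T, ∫ x, F' (t, x) = 1 / 2 * ∫ x, (x 0 * Ds 0 K x + x 1 * Ds 1 K x) *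
      (Dx 0 f (t, x) ^ 2 + Dx 1 f (t, x) ^ 2) := by
    intro t ht
    let V : Fin 2 → E2 → ℝ := fun j x =>
      (t * Dt f (t, x) + 1 / 2 * f (t, x) + (x 0 * Dx 0 f (t, x) + x 1 * Dx 1 f (t, x))) *
        (K x * Dx j f (t, x)) + x j * (1 / 2 * (Dt f (t, x) ^ 2 -
          K x * (Dx 0 f (t, x) ^ 2 + Dx 1 f (t, x) ^ 2)))
    let d : Fin 2 → E2 → ℝ := fun j x =>
      (t * Dx j (Dt f) (t, x) + 1 / 2 * Dx j f (t, x) + (Dx j f (t, x) +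
          (x 0 * Dx j (Dx 0 f) (t, x) + x 1 * Dx j (Dx 1 f) (t, x)))) *
        (K x * Dx j f (t, x)) +
      (t * Dt f (t, x) + 1 / 2 * f (t, x) + (x 0 * Dx 0 f (t, x) + x 1 * Dx 1 f (t, x))) *
        (Ds j K x * Dx j f (t, x) + K x * Dx j (Dx j f) (t, x)) +
      (1 / 2 * (Dt f (t, x) ^ 2 - K x * (Dx 0 f (t, x) ^ 2 + Dx 1 f (t, x) ^ 2))) +
      x j * (1 / 2 * (2 * Dt f (t, x) * Dx j (Dt f) (t, x) -
          (Ds j K x * (Dx 0 f (t, x) ^ 2 + Dx 1 f (t, x) ^ 2) +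
          K x * (2 * Dx 0 f (t, x) * Dx j (Dx 0 f) (t, x) +
            2 * Dx 1 f (t, x) * Dx j (Dx 1 f) (t, x)))))
    have hV : ∀ j (x : E2), HasDerivAt (fun s : ℝ => V j (x + s • ee j)) (d j x) 0 := by
      intro j x
      have a0 := coord_hasDerivAt j 0 x
      have a1 := coord_hasDerivAt j 1 x
      have aj := coord_hasDerivAt j j x
      have b := Dx_hasDerivAt hf j t x
      have bt := Dx_hasDerivAt (Dt_smooth hf) j t x
      have b0 := Dx_hasDerivAt (Dx_smooth 0 hf) j t x
      have b1 := Dx_hasDerivAt (Dx_smooth 1 hf) j t x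
      have bj := Dx_hasDerivAt (Dx_smooth j hf) j t x
      have k := Ds_hasDerivAt hK j x
      have := ((((bt.const_mul t).add (b.const_mul (1 / 2))).add
        ((a0.mul b0).add (a1.mul b1))).mul (k.mul bj)).add
        (aj.mul (((bt.pow 2).sub (k.mul ((b0.pow 2).add (b1.pow 2)))).const_mul (1 / 2)))
      refine this.congr_deriv ?_
      simp only [d, Nat.cast_ofNat, Nat.reduceSub, pow_one, Pi.add_apply, Pi.pow_apply,
        Pi.mul_apply, Pi.sub_apply, zero_smul, add_zero]
      fin_cases j <;> simp <;> ring
    have zV : ∀ j x, x ∉ C → V j x = 0 := by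
      intro j x hx
      simp [V, hzx t ht _ x hx, hzt t ht x hx]
    rw [integral_sub_div hC (G := fun x => F' (t, x)) (V0 := V 0) (V1 := V 1) (d0 := d 0)
      (d1 := d 1) (by fun_prop) (zF' t ht) (by fun_prop) (by fun_prop) (by fun_prop) (by fun_prop)
      (hV 0) (hV 1) (zV 0) (zV 1), ← integral_const_mul]
    congr 1
    funext x
    simp only [F', F1, F2, d]
    rw [hS t x ht.1, hsym]
    ring
  have hfin : ∫ t in (0 : ℝ)..T, ∫ x, F' (t, x) = 1 / 2 * ∫ s in (0 : ℝ)..T, ∫ x,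
      (x 0 * Ds 0 K x + x 1 * Ds 1 K x) * (Dx 0 f (s, x) ^ 2 + Dx 1 f (s, x) ^ 2) := by
    rw [← intervalIntegral.integral_const_mul]
    apply intervalIntegral.integral_congr
    intro t ht
    rw [uIcc_of_le hT.le] at ht
    exact hslice t ht
  rw [hsplit T ⟨hT.le, le_rfl⟩, hsplit 0 ⟨le_rfl, hT.le⟩, hfin] at hftc
  simp only [F1, F2, F3, F4] at hftc
  linarith

/-- the Morawetz identity for the variable-coefficient wave equation. -/
theorem stmt_10
    (K : EuclideanSpace ℝ (Fin 2) → ℝ) (hK : ContDiff ℝ 1 K)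
    (hKbd : ∃ M : ℝ, ∀ x, |K x| + ‖gradient K x‖ ≤ M)
    (u : ℝ → EuclideanSpace ℝ (Fin 2) → ℝ)
    (hu : ContDiff ℝ (⊤ : ℕ∞) (fun p : ℝ × EuclideanSpace ℝ (Fin 2) => u p.1 p.2))
    (u₀ u₁ : EuclideanSpace ℝ (Fin 2) → ℝ)
    (hu₀ : ContDiff ℝ (⊤ : ℕ∞) u₀) (hu₁ : ContDiff ℝ (⊤ : ℕ∞) u₁)
    (hc₀ : HasCompactSupport u₀) (hc₁ : HasCompactSupport u₁)
    (ut : ℝ → EuclideanSpace ℝ (Fin 2) → ℝ)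
    (hut : ∀ t x, ut t x = deriv (fun s => u s x) t)
    (hinit0 : ∀ x, u 0 x = u₀ x) (hinit1 : ∀ x, ut 0 x = u₁ x)
    (hPDE : ∀ t x, 0 < t →
      deriv (fun s => ut s x) t = div2 (fun y => K y • gradient (u t) y) x)
    (E : ℝ → ℝ)
    (hE : ∀ t, E t = (1 / 2) * ((∫ x, (ut t x) ^ 2) + ∫ x, K x * ‖gradient (u t) x‖ ^ 2))
    (J₀ : ℝ)
    (hJ₀ : J₀ = (1 / 2) * (∫ x, u₁ x * u₀ x) + ∫ x, u₁ x * ⟪x, gradient u₀ x⟫) :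
    ∀ t : ℝ, 0 ≤ t →
      t * E t + (1 / 2) * (∫ x, ut t x * u t x)
          + (∫ x, ut t x * ⟪x, gradient (u t) x⟫)
        = J₀ + (1 / 2) * ∫ s in Set.Ioc (0 : ℝ) t,
            ∫ x, ⟪x, gradient K x⟫ * ‖gradient (u s) x‖ ^ 2 := by
  intro T hT
  have eu0 : u 0 = u₀ := funext hinit0
  have eut0 : ut 0 = u₁ := funext hinit1
  rw [← eu0, ← eut0] at hJ₀
  rcases hT.eq_or_lt with hT0 | hT0
  · subst hT0
    rw [hJ₀]; simp
  obtain ⟨f, hfdef⟩ : ∃ f : ℝ × E2 → ℝ, f = fun p => u p.1 p.2 := ⟨_, rfl⟩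
  have hf : ContDiff ℝ (⊤ : ℕ∞) f := by rw [hfdef]; exact hu
  have hfu : ∀ t x, u t x = f (t, x) := by intro t x; rw [hfdef]
  have hfu' : ∀ t, u t = fun x => f (t, x) := fun t => funext (hfu t)
  have hutf : ∀ t x, ut t x = Dt f (t, x) := by
    intro t x
    rw [hut]
    simp_rw [hfu]
    exact (Dt_hasDerivAt hf t x).deriv
  have hgrad : ∀ t x i, gradient (u t) x i = Dx i f (t, x) := by
    intro t x i
    rw [gradient_coord, hfu', Ds_slice hf]
  have hS : Sol K f := by
    apply Sol_of_pos hf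
    intro t x ht
    have := hPDE t x ht
    simp_rw [hutf] at this
    rw [(Dt_hasDerivAt (Dt_smooth hf) t x).deriv, hfu', div2_eq hK hf] at this
    exact this
  obtain ⟨M, hM⟩ := hKbd
  have hKc : ∀ x, |K x| ≤ (|M| + 1) ^ 2 := by
    intro x
    have h1 := hM x
    have h2 := norm_nonneg (gradient K x)
    have h3 := le_abs_self M
    nlinarith [abs_nonneg M]
  have hcp : 0 < |M| + 1 := by positivity
  obtain ⟨R, hR⟩ : ∃ R : ℝ, ∀ x : E2, R < ‖x‖ → u₀ x = 0 ∧ u₁ x = 0 := by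
    obtain ⟨R1, hR1⟩ := hc₀.isCompact.isBounded.subset_closedBall (0 : E2)
    obtain ⟨R2, hR2⟩ := hc₁.isCompact.isBounded.subset_closedBall (0 : E2)
    refine ⟨max R1 R2, fun x hx => ⟨?_, ?_⟩⟩
    · apply image_eq_zero_of_notMem_tsupport
      intro h
      have := hR1 h
      rw [mem_closedBall_zero_iff] at this
      exact absurd (this.trans (le_max_left R1 R2)) (not_le.2 hx)
    · apply image_eq_zero_of_notMem_tsupport
      intro h
      have := hR2 h
      rw [mem_closedBall_zero_iff] at this
      exact absurd (this.trans (le_max_right R1 R2)) (not_le.2 hx)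
  have hfs := finite_speed hK hf hS hcp hKc
    (fun x hx => by rw [← hfu, hinit0]; exact (hR x hx).1)
    (fun x hx => by rw [← hutf, hinit1]; exact (hR x hx).2)
  have hout : ∀ t ∈ Icc 0 T, ∀ x, x ∉ Metric.closedBall (0 : E2) (R + (|M| + 1) * T) →
      f (t, x) = 0 ∧ Dt f (t, x) = 0 := by
    intro t ht x hx
    rw [mem_closedBall_zero_iff, not_le] at hx
    have := mul_le_mul_of_nonneg_left ht.2 hcp.le
    exact hfs t ht.1 x (by linarith)
  have key := morawetz hK hf hS (isCompact_closedBall (0 : E2) (R + (|M| + 1) * T)) hT0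
    (fun t ht x hx => (hout t ht x hx).1) (fun t ht x hx => (hout t ht x hx).2)
  rw [hE, hJ₀, ← intervalIntegral.integral_of_le hT]
  simp only [E2_norm_sq, E2_inner, hgrad, gradient_coord K, hutf, hfu]
  exact key
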